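/- Let p ≥ 0 be an integer, n* > 1, ε > 0, and let κ : (n*−ε, n*+ε) → ℂ be a continuous ITE trajectory (F_p(κ(n), n) = 0 for all n) that is differentiable at every n ≠ n*. Suppose κ(n*) = κ* > 0 with J_p(κ*) = 0 and J_p'(κ*) ≠ 0, and that J_p(κ(n)) ≠ 0 and J_p(√n·κ(n)) ≠ 0 for every n ≠ n*. Then the one-sided limits lim_{n↗n*} arg(κ'(n)) and lim_{n↘n*} arg(κ'(n)) exist and each belongs to the set {−π/3, π/3, π}; moreover, a one-sided limit equals π if and only if κ(n) is real for all n on the corresponding side of n* sufficiently close to n* (in particular, if Im κ(n) ≠ 0 for n ≠ n*, then both one-sided limits lie in {−π/3, π/3}). -/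

import Mathlib

open Complex Real Filter Set

/-- Bessel function of the first kind of integer order `p`. -/
noncomputable def besselJ (p : ℕ) (z : ℂ) : ℂ :=
  ∑' m : ℕ, ((-1 : ℂ) ^ m / ((Nat.factorial m : ℂ) * (Nat.factorial (m + p) : ℂ)))
    * (z / 2) ^ (2 * m + p)

/-- Derivative of the Bessel function. -/
noncomputable def besselJ' (p : ℕ) (z : ℂ) : ℂ := deriv (besselJ p) z

/-- The ITE determinant function `F_p(κ, n)`. -/
noncomputable def Fp (p : ℕ) (κ : ℂ) (n : ℝ) : ℂ :=
  κ * (besselJ' p κ * besselJ p ((Real.sqrt n : ℂ) * κ)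
    - (Real.sqrt n : ℂ) * besselJ p κ * besselJ' p ((Real.sqrt n : ℂ) * κ))

open scoped Topology ComplexConjugate

/-- The entire function `E_p` with `J_p z = (z / 2) ^ p * E_p ((z / 2) ^ 2)`. -/
noncomputable def besselSeries (p : ℕ) (x : ℂ) : ℂ :=
  ∑' m : ℕ, ((-1 : ℂ) ^ m / ((Nat.factorial m : ℂ) * (Nat.factorial (m + p) : ℂ))) * x ^ m

theorem besselJ_eq_pow_mul_besselSeries (p : ℕ) (z : ℂ) :
    besselJ p z = (z / 2) ^ p * besselSeries p ((z / 2) ^ 2) := by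
  rw [besselJ, besselSeries, ← tsum_mul_left]
  congr 1 with m
  rw [pow_add, pow_mul]
  ring

theorem norm_besselSeries_coeff_le (p m : ℕ) :
    ‖(-1 : ℂ) ^ m / ((Nat.factorial m : ℂ) * (Nat.factorial (m + p) : ℂ))‖
      ≤ 1 / (Nat.factorial m : ℝ) := by
  have h1 : (0 : ℝ) < (Nat.factorial m : ℝ) := by exact_mod_cast Nat.factorial_pos m
  have h2 : (1 : ℝ) ≤ (Nat.factorial (m + p) : ℝ) := by exact_mod_cast Nat.factorial_pos (m + p)
  simp only [norm_div, norm_pow, norm_neg, norm_one, one_pow, norm_mul, Complex.norm_natCast]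
  exact one_div_le_one_div_of_le h1 (le_mul_of_one_le_right h1.le h2)

theorem summable_besselSeries (p : ℕ) (x : ℂ) :
    Summable fun m : ℕ =>
      ((-1 : ℂ) ^ m / ((Nat.factorial m : ℂ) * (Nat.factorial (m + p) : ℂ))) * x ^ m := by
  refine Summable.of_norm_bounded (Real.summable_pow_div_factorial ‖x‖) fun m => ?_
  rw [norm_mul, norm_pow]
  calc _ ≤ 1 / (Nat.factorial m : ℝ) * ‖x‖ ^ m :=
        mul_le_mul_of_nonneg_right (norm_besselSeries_coeff_le p m) (by positivity)
    _ = _ := by ring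

theorem hasDerivAt_besselSeries (p : ℕ) (x : ℂ) :
    HasDerivAt (besselSeries p) (-besselSeries (p + 1) x) x := by
  set R := ‖x‖ + 1
  have hR : 0 ≤ R := by positivity
  have hu : Summable fun m : ℕ => (1 / (Nat.factorial m : ℝ)) * (m * R ^ (m - 1)) := by
    rw [← summable_nat_add_iff 1]
    refine (Real.summable_pow_div_factorial R).congr fun m => ?_
    have : (Nat.factorial m : ℝ) ≠ 0 := by exact_mod_cast Nat.factorial_ne_zero m
    rw [Nat.factorial_succ]
    push_cast
    field_simp
  have key := hasDerivAt_tsum_of_isPreconnected (𝕜 := ℂ) (F := ℂ)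
    (g := fun (m : ℕ) (y : ℂ) =>
      ((-1 : ℂ) ^ m / ((Nat.factorial m : ℂ) * (Nat.factorial (m + p) : ℂ))) * y ^ m)
    (g' := fun (m : ℕ) (y : ℂ) =>
      ((-1 : ℂ) ^ m / ((Nat.factorial m : ℂ) * (Nat.factorial (m + p) : ℂ)))
        * (m * y ^ (m - 1)))
    (t := Metric.ball 0 R) (y₀ := x) (y := x) hu Metric.isOpen_ball
    (convex_ball (0 : ℂ) R).isPreconnected
    (fun m y _ => (hasDerivAt_pow m y).const_mul _)
    (fun m y hy => by
      rw [norm_mul, norm_mul, norm_pow, Complex.norm_natCast]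
      have hy' : ‖y‖ ≤ R := by simpa using (Metric.mem_ball.1 hy).le
      gcongr
      exact norm_besselSeries_coeff_le p m)
    (by simp [R]) (summable_besselSeries p x) (by simp [R])
  refine HasDerivAt.congr_deriv (f := besselSeries p) key ?_
  have hs : Summable fun m : ℕ =>
      ((-1 : ℂ) ^ m / ((Nat.factorial m : ℂ) * (Nat.factorial (m + p) : ℂ)))
        * (m * x ^ (m - 1)) := by
    refine Summable.of_norm_bounded hu fun m => ?_
    rw [norm_mul, norm_mul, norm_pow, Complex.norm_natCast]
    gcongr
    · exact norm_besselSeries_coeff_le p m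
    · simp [R]
  rw [hs.tsum_eq_zero_add, besselSeries, ← tsum_neg]
  simp only [Nat.cast_zero, zero_mul, mul_zero, zero_add, Nat.add_sub_cancel]
  congr 1 with m
  have : (Nat.factorial m : ℂ) ≠ 0 := by exact_mod_cast Nat.factorial_ne_zero m
  have h2 : (Nat.factorial (m + p + 1) : ℂ) ≠ 0 := by exact_mod_cast Nat.factorial_ne_zero _
  have h3 : (m : ℂ) + 1 ≠ 0 := by exact_mod_cast Nat.succ_ne_zero m
  rw [show m + 1 + p = m + p + 1 by ring, show m + (p + 1) = m + p + 1 by ring,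
    Nat.factorial_succ m, pow_succ]
  push_cast
  field_simp

theorem besselSeries_recurrence (p : ℕ) (x : ℂ) :
    besselSeries p x = (p + 1) * besselSeries (p + 1) x - x * besselSeries (p + 2) x := by
  have h1 : Summable fun m : ℕ => (m : ℂ) *
      (((-1 : ℂ) ^ m / ((Nat.factorial m : ℂ) * (Nat.factorial (m + (p + 1)) : ℂ))) * x ^ m) := by
    have := ((summable_besselSeries p x).sub
      ((summable_besselSeries (p + 1) x).mul_left ((p : ℂ) + 1)))
    refine this.congr fun m => ?_
    have : (Nat.factorial m : ℂ) ≠ 0 := by exact_mod_cast Nat.factorial_ne_zero m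
    have h2 : (Nat.factorial (m + p) : ℂ) ≠ 0 := by exact_mod_cast Nat.factorial_ne_zero _
    have h3 : (m : ℂ) + p + 1 ≠ 0 := by exact_mod_cast Nat.succ_ne_zero (m + p)
    rw [show m + (p + 1) = m + p + 1 by ring, Nat.factorial_succ (m + p)]
    push_cast
    field_simp
    ring
  have h2 : -(x * besselSeries (p + 2) x) = ∑' m : ℕ, (m : ℂ) *
      (((-1 : ℂ) ^ m / ((Nat.factorial m : ℂ) * (Nat.factorial (m + (p + 1)) : ℂ))) * x ^ m) := by
    rw [h1.tsum_eq_zero_add, besselSeries, ← tsum_mul_left, ← tsum_neg]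
    simp only [Nat.cast_zero, zero_mul, zero_add]
    congr 1 with m
    have : (Nat.factorial m : ℂ) ≠ 0 := by exact_mod_cast Nat.factorial_ne_zero m
    have h2 : (Nat.factorial (m + (p + 2)) : ℂ) ≠ 0 := by exact_mod_cast Nat.factorial_ne_zero _
    have h3 : (m : ℂ) + 1 ≠ 0 := by exact_mod_cast Nat.succ_ne_zero m
    rw [show m + 1 + (p + 1) = m + (p + 2) by ring, Nat.factorial_succ m, pow_succ]
    push_cast
    field_simp
    ring
  rw [sub_eq_add_neg, h2, besselSeries, besselSeries, ← tsum_mul_left,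
    ← ((summable_besselSeries (p + 1) x).mul_left ((p : ℂ) + 1)).tsum_add h1]
  congr 1 with m
  have : (Nat.factorial m : ℂ) ≠ 0 := by exact_mod_cast Nat.factorial_ne_zero m
  have h2 : (Nat.factorial (m + p) : ℂ) ≠ 0 := by exact_mod_cast Nat.factorial_ne_zero _
  have h3 : (m : ℂ) + p + 1 ≠ 0 := by exact_mod_cast Nat.succ_ne_zero (m + p)
  rw [show m + (p + 1) = m + p + 1 by ring, Nat.factorial_succ (m + p)]
  push_cast
  field_simp
  ring

theorem hasDerivAt_besselJ (p : ℕ) {z : ℂ} (hz : z ≠ 0) :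
    HasDerivAt (besselJ p) (p / z * besselJ p z - besselJ (p + 1) z) z := by
  have hd : HasDerivAt (fun w : ℂ => w / 2) (1 / 2) z := (hasDerivAt_id z).div_const 2
  have h := (hd.pow p).mul ((hasDerivAt_besselSeries p ((z / 2) ^ 2)).comp z (hd.pow 2))
  have hfun : besselJ p = (fun w => (w / 2) ^ p) * (besselSeries p ∘ fun w => (w / 2) ^ 2) := by
    ext w
    simpa using besselJ_eq_pow_mul_besselSeries p w
  rw [hfun]
  refine HasDerivAt.congr_deriv h ?_
  rw [← hfun]
  simp only [Function.comp, Pi.pow_apply, besselJ_eq_pow_mul_besselSeries]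
  rcases p with _ | p
  · simp
    ring
  · simp only [Nat.add_sub_cancel]
    push_cast
    field_simp
    ring

theorem hasDerivAt_besselJ_succ (p : ℕ) {z : ℂ} (hz : z ≠ 0) :
    HasDerivAt (besselJ (p + 1)) (besselJ p z - (p + 1) / z * besselJ (p + 1) z) z := by
  convert hasDerivAt_besselJ (p + 1) hz using 1
  simp only [besselJ_eq_pow_mul_besselSeries]
  rw [besselSeries_recurrence p]
  push_cast
  field_simp
  ring

theorem differentiable_besselJ (p : ℕ) : Differentiable ℂ (besselJ p) := by
  have hE : Differentiable ℂ (besselSeries p) :=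
    fun x => (hasDerivAt_besselSeries p x).differentiableAt
  have hfun : besselJ p = fun w => (w / 2) ^ p * besselSeries p ((w / 2) ^ 2) := by
    ext w
    exact besselJ_eq_pow_mul_besselSeries p w
  rw [hfun]
  exact ((differentiable_id.div_const 2).pow p).mul
    (hE.comp ((differentiable_id.div_const 2).pow 2))

theorem analyticAt_besselJ (p : ℕ) (z : ℂ) : AnalyticAt ℂ (besselJ p) z :=
  (differentiable_besselJ p).analyticAt z

theorem analyticAt_besselJ' (p : ℕ) (z : ℂ) : AnalyticAt ℂ (besselJ' p) z :=
  (analyticAt_besselJ p z).deriv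

theorem hasDerivAt_besselJ_deriv (p : ℕ) (z : ℂ) :
    HasDerivAt (besselJ p) (besselJ' p z) z :=
  (differentiable_besselJ p z).hasDerivAt

theorem besselJ'_eq (p : ℕ) {z : ℂ} (hz : z ≠ 0) :
    besselJ' p z = p / z * besselJ p z - besselJ (p + 1) z :=
  (hasDerivAt_besselJ p hz).deriv

theorem besselJ_conj (p : ℕ) (z : ℂ) : besselJ p (conj z) = conj (besselJ p z) := by
  rw [besselJ, besselJ, Complex.conj_tsum]
  congr 1 with m
  simp [Complex.conj_ofNat]

theorem besselJ'_conj (p : ℕ) {z : ℂ} (hz : z ≠ 0) :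
    besselJ' p (conj z) = conj (besselJ' p z) := by
  rw [besselJ'_eq p hz, besselJ'_eq p (by simpa using hz)]
  simp [besselJ_conj]

/-- Bessel's differential equation. -/
theorem hasDerivAt_besselJ' (p : ℕ) {z : ℂ} (hz : z ≠ 0) :
    HasDerivAt (besselJ' p)
      (-(besselJ' p z / z) - (1 - (p : ℂ) ^ 2 / z ^ 2) * besselJ p z) z := by
  have h : HasDerivAt (fun w => p / w * besselJ p w - besselJ (p + 1) w) _ z :=
    (((hasDerivAt_inv hz).const_mul (p : ℂ)).mul (hasDerivAt_besselJ p hz)).sub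
      (hasDerivAt_besselJ_succ p hz)
  refine (h.congr_of_eventuallyEq ?_).congr_deriv ?_
  · filter_upwards [isOpen_ne.mem_nhds hz] with w hw
    exact besselJ'_eq p hw
  · rw [besselJ'_eq p hz]
    field_simp
    ring

/-- A nonzero zero of a Bessel function that is not locally constant is simple. -/
theorem besselJ'_ne_zero_of_zero (p : ℕ) {b : ℂ} (hb : b ≠ 0) (hJ : besselJ p b = 0)
    (hne : ∃ᶠ z in 𝓝 b, besselJ p z ≠ 0) : besselJ' p b ≠ 0 := by
  intro hJ'
  have han := analyticAt_besselJ p b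
  have hord : analyticOrderAt (besselJ p) b ≠ ⊤ := fun h =>
    hne (by simpa using analyticOrderAt_eq_top.1 h)
  obtain ⟨k, hk⟩ := ENat.ne_top_iff_exists.1 hord
  have h1 : analyticOrderAt (besselJ' p) b + 1 = analyticOrderAt (besselJ p) b := by
    have := han.analyticOrderAt_deriv_add_one
    simp only [hJ, sub_zero] at this
    exact this
  have h2 : analyticOrderAt (deriv (besselJ' p)) b + 1 = analyticOrderAt (besselJ' p) b := by
    have := (analyticAt_besselJ' p b).analyticOrderAt_deriv_add_one
    simp only [hJ', sub_zero] at this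
    exact this
  have h0 : analyticOrderAt (deriv (besselJ' p)) b ≠ ⊤ := by
    intro h
    rw [h] at h2
    rw [← h2] at h1
    exact hord (by simpa using h1.symm)
  obtain ⟨j, hj⟩ := ENat.ne_top_iff_exists.1 h0
  have e1 : analyticOrderAt (besselJ' p) b = (j + 1 : ℕ) := by rw [← h2, ← hj]; rfl
  have e2 : analyticOrderAt (besselJ p) b = (j + 2 : ℕ) := by rw [← h1, e1]; rfl
  obtain ⟨g1, hg1, -, hg1e⟩ := ((analyticAt_besselJ' p b).analyticOrderAt_eq_natCast).1 e1
  obtain ⟨g2, hg2, -, hg2e⟩ := (han.analyticOrderAt_eq_natCast).1 e2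
  have hlt : ((j + 1 : ℕ) : ℕ∞) ≤ analyticOrderAt (deriv (besselJ' p)) b := by
    rw [natCast_le_analyticOrderAt (analyticAt_besselJ' p b).deriv]
    refine ⟨fun z => -(g1 z / z) - (1 - (p : ℂ) ^ 2 / z ^ 2) * ((z - b) * g2 z), ?_, ?_⟩
    · have hid : AnalyticAt ℂ (fun z : ℂ => z) b := analyticAt_id
      refine ((hg1.div hid hb).neg).sub ((analyticAt_const.sub
        (analyticAt_const.div (hid.pow 2) (pow_ne_zero 2 hb))).mul
          ((hid.sub analyticAt_const).mul hg2))
    · filter_upwards [hg1e, hg2e, isOpen_ne.mem_nhds hb] with z h1 h2 h3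
      rw [(hasDerivAt_besselJ' p h3).deriv, h1, h2]
      simp only [smul_eq_mul]
      ring
  rw [← hj] at hlt
  have : j + 1 ≤ j := by exact_mod_cast hlt
  omega

/-- The quotient `J_p z / (z * J_p' z)`, which satisfies a Riccati equation. -/
noncomputable def besselRatio (p : ℕ) (z : ℂ) : ℂ := besselJ p z / (z * besselJ' p z)

theorem analyticAt_besselRatio (p : ℕ) {z : ℂ} (hz : z ≠ 0) (hJ' : besselJ' p z ≠ 0) :
    AnalyticAt ℂ (besselRatio p) z :=
  (analyticAt_besselJ p z).div (analyticAt_id.mul (analyticAt_besselJ' p z)) (mul_ne_zero hz hJ')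

theorem hasDerivAt_besselRatio (p : ℕ) {z : ℂ} (hz : z ≠ 0) (hJ' : besselJ' p z ≠ 0) :
    HasDerivAt (besselRatio p) ((1 + (z ^ 2 - p ^ 2) * besselRatio p z ^ 2) / z) z := by
  have h : HasDerivAt (besselRatio p) _ z :=
    (hasDerivAt_besselJ_deriv p z).div ((hasDerivAt_id z).mul (hasDerivAt_besselJ' p hz))
      (mul_ne_zero hz hJ')
  refine h.congr_deriv ?_
  simp only [besselRatio, id]
  field_simp
  ring

/-- If `N'` has a double zero at `a` with negative leading coefficient, then `N a - N` is locally
the cube of an analytic function whose derivative at `a` is positive. -/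
theorem exists_cube_root_of_deriv_eq {N g : ℂ → ℂ} {a : ℂ} {C : ℝ} (hC : 0 < C)
    (hN : AnalyticAt ℂ N a) (hg : AnalyticAt ℂ g a) (hga : g a = -C)
    (hd : ∀ᶠ z in 𝓝 a, deriv N z = (z - a) ^ 2 * g z) :
    ∃ φ : ℂ → ℂ, ∃ c : ℝ, 0 < c ∧ AnalyticAt ℂ φ a ∧ φ a = 0 ∧ deriv φ a = c ∧
      ∀ᶠ z in 𝓝 a, φ z ^ 3 = -(N z - N a) := by
  have hC0 : (C : ℂ) ≠ 0 := by exact_mod_cast hC.ne'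
  have hord : analyticOrderAt (deriv N) a = (2 : ℕ) :=
    (hN.deriv.analyticOrderAt_eq_natCast).2 ⟨g, hg, by simpa [hga] using hC0, by simpa using hd⟩
  have hord' : analyticOrderAt (fun z => N z - N a) a = (3 : ℕ) := by
    rw [← hN.analyticOrderAt_deriv_add_one, hord]
    rfl
  obtain ⟨G, hG, -, hGe⟩ :=
    ((hN.sub analyticAt_const).analyticOrderAt_eq_natCast).1 hord'
  simp only [smul_eq_mul] at hGe
  have hGa : G a = -(C / 3 : ℝ) := by
    have hlim : Tendsto (fun z => 3 * G z + (z - a) * deriv G z) (𝓝[≠] a) (𝓝 (3 * G a)) := by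
      have : ContinuousAt (fun z => 3 * G z + (z - a) * deriv G z) a :=
        (continuousAt_const.mul hG.continuousAt).add
          ((continuousAt_id.sub continuousAt_const).mul hG.deriv.continuousAt)
      simpa using this.tendsto.mono_left nhdsWithin_le_nhds
    have heq : g =ᶠ[𝓝[≠] a] fun z => 3 * G z + (z - a) * deriv G z := by
      have h1 := (hGe.eventually_nhds.and (hG.eventually_analyticAt.and hd)).filter_mono
        (nhdsWithin_le_nhds (s := {a}ᶜ))
      filter_upwards [h1, self_mem_nhdsWithin] with z ⟨hz, hGz, hdz⟩ hza
      have hza' : z - a ≠ 0 := sub_ne_zero.2 hza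
      have h2 : HasDerivAt (fun z => (z - a) ^ 3 * G z) _ z :=
        (((hasDerivAt_id z).sub_const a).pow 3).mul hGz.differentiableAt.hasDerivAt
      have h3 : deriv (fun z => N z - N a) z = deriv (fun z => (z - a) ^ 3 * G z) z :=
        Filter.EventuallyEq.deriv_eq hz
      rw [deriv_sub_const, h2.deriv, hdz] at h3
      have h4 : (z - a) ^ 2 * (g z - (3 * G z + (z - a) * deriv G z)) = 0 := by
        simp only [Pi.pow_apply, id] at h3
        linear_combination h3
      exact sub_eq_zero.1 ((mul_eq_zero.1 h4).resolve_left (pow_ne_zero 2 hza'))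
    have h5 := tendsto_nhds_unique
      ((hg.continuousAt.tendsto.mono_left nhdsWithin_le_nhds).congr' heq) hlim
    push_cast
    linear_combination (-1 / 3 : ℂ) * h5 + (1 / 3 : ℂ) * hga
  have hslit : -G a ∈ Complex.slitPlane := by
    rw [hGa, neg_neg]
    exact Complex.ofReal_mem_slitPlane.2 (by positivity)
  have hroot : AnalyticAt ℂ (fun z => (-G z) ^ (((3 : ℕ) : ℂ)⁻¹)) a :=
    hG.neg.cpow analyticAt_const hslit
  refine ⟨fun z => (z - a) * (-G z) ^ (((3 : ℕ) : ℂ)⁻¹), (C / 3) ^ (((3 : ℕ) : ℝ)⁻¹),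
    by positivity, (analyticAt_id.sub analyticAt_const).mul hroot, by simp, ?_, ?_⟩
  · have h : HasDerivAt (fun z => (z - a) * (-G z) ^ (((3 : ℕ) : ℂ)⁻¹)) _ a :=
      ((hasDerivAt_id a).sub_const a).mul hroot.differentiableAt.hasDerivAt
    rw [h.deriv, hGa, neg_neg, Complex.ofReal_cpow (by positivity)]
    simp
  · filter_upwards [hGe] with z hz
    rw [mul_pow, Complex.cpow_nat_inv_pow _ (by norm_num)]
    have hz' : N z - N a = (z - a) ^ 3 * G z := hz
    rw [hz']
    ring

theorem exists_cube_root_of_besselRatio (p : ℕ) {a b : ℝ} (ha : 0 < a) (hab : a < b)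
    (hJa : besselJ p a = 0) (hJa' : besselJ' p a ≠ 0)
    (hJb : besselJ p b = 0) (hJb' : besselJ' p b ≠ 0) :
    ∃ φ : ℂ → ℂ, ∃ c : ℝ, 0 < c ∧ AnalyticAt ℂ φ a ∧ φ a = 0 ∧ deriv φ a = c ∧
      ∀ᶠ q : ℂ × ℂ in 𝓝 ((a : ℂ), (b : ℂ)), besselRatio p q.1 = besselRatio p q.2 →
        φ q.1 ^ 3 = -((q.2 / q.1) ^ 2 - ((b : ℂ) / a) ^ 2) := by
  have hb : 0 < b := ha.trans hab
  have ha0 : (a : ℂ) ≠ 0 := by exact_mod_cast ha.ne'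
  have hb0 : (b : ℂ) ≠ 0 := by exact_mod_cast hb.ne'
  have hra := analyticAt_besselRatio p ha0 hJa'
  have hrb := analyticAt_besselRatio p hb0 hJb'
  have hra0 : besselRatio p a = 0 := by simp [besselRatio, hJa]
  have hrb0 : besselRatio p b = 0 := by simp [besselRatio, hJb]
  have hda : deriv (besselRatio p) a = 1 / a := by
    rw [(hasDerivAt_besselRatio p ha0 hJa').deriv, hra0]
    simp
  have hdb : deriv (besselRatio p) b ≠ 0 := by
    rw [(hasDerivAt_besselRatio p hb0 hJb').deriv, hrb0]
    simpa using hb0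
  set ψ := hrb.hasStrictDerivAt.localInverse _ _ _ hdb with hψ
  have hψan : AnalyticAt ℂ ψ 0 := by
    have := hrb.analyticAt_localInverse hdb
    rwa [hrb0] at this
  have hψleft : ∀ᶠ x in 𝓝 (b : ℂ), ψ (besselRatio p x) = x :=
    hrb.hasStrictDerivAt.eventually_left_inverse hdb
  have hψright : ∀ᶠ w in 𝓝 (0 : ℂ), besselRatio p (ψ w) = w := by
    have := hrb.hasStrictDerivAt.eventually_right_inverse hdb
    rwa [hrb0] at this
  have hψ0 : ψ 0 = b := by
    have := hψleft.self_of_nhds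
    rwa [hrb0] at this
  set u : ℂ → ℂ := fun z => ψ (besselRatio p z) with hu
  have hua : u a = b := by rw [hu]; simp only [hra0, hψ0]
  have huan : AnalyticAt ℂ u a := AnalyticAt.comp (by rwa [hra0]) hra
  obtain ⟨r, hr, hre⟩ : ∃ r : ℂ → ℂ, AnalyticAt ℂ r a ∧
      ∀ᶠ z in 𝓝 (a : ℂ), besselRatio p z = (z - a) * r z := by
    have h1 : ((1 : ℕ) : ℕ∞) ≤ analyticOrderAt (besselRatio p) a :=
      hra.analyticOrderAt_eq_one_of_zero_deriv_ne_zero hra0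
        (by rw [hda]; exact one_div_ne_zero ha0) |>.ge
    simpa using (natCast_le_analyticOrderAt hra).1 h1
  have hrval : r a = 1 / a := by
    have h : HasDerivAt (fun z => (z - a) * r z) _ (a : ℂ) :=
      ((hasDerivAt_id (a : ℂ)).sub_const (a : ℂ)).mul hr.differentiableAt.hasDerivAt
    have h1 := Filter.EventuallyEq.deriv_eq hre
    rw [hda, h.deriv] at h1
    simpa using h1.symm
  have hid : AnalyticAt ℂ (fun z : ℂ => z) a := analyticAt_id
  have hden : AnalyticAt ℂ
      (fun z => z ^ 3 * (1 + (u z ^ 2 - p ^ 2) * besselRatio p z ^ 2)) a :=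
    (hid.pow 3).mul (analyticAt_const.add (((huan.pow 2).sub analyticAt_const).mul (hra.pow 2)))
  have hden0 : (a : ℂ) ^ 3 * (1 + (u a ^ 2 - p ^ 2) * besselRatio p a ^ 2) ≠ 0 := by
    simp [hra0, ha0]
  obtain ⟨φ, c, hc, hφ, hφa, hφd, hφe⟩ := exists_cube_root_of_deriv_eq
    (N := fun z => (u z / z) ^ 2) (a := a) (C := 2 * b ^ 2 * (b ^ 2 - a ^ 2) / a ^ 5)
    (g := fun z => 2 * u z ^ 2 * (z ^ 2 - u z ^ 2) * r z ^ 2 /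
      (z ^ 3 * (1 + (u z ^ 2 - p ^ 2) * besselRatio p z ^ 2)))
    (by
      have : 0 < b ^ 2 - a ^ 2 := by nlinarith
      positivity)
    ((huan.div hid ha0).pow 2)
    ((((analyticAt_const.mul (huan.pow 2)).mul ((hid.pow 2).sub (huan.pow 2))).mul
      (hr.pow 2)).div hden hden0)
    (by
      simp only [hua, hra0, hrval]
      push_cast
      field_simp
      ring)
    (by
      have hnear : ∀ᶠ z in 𝓝 (a : ℂ), z ≠ 0 ∧ besselJ' p z ≠ 0 :=
        (isOpen_ne.eventually_mem ha0).and
          ((analyticAt_besselJ' p a).continuousAt.eventually_ne hJa')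
      have hnearu : ∀ᶠ z in 𝓝 (a : ℂ), u z ≠ 0 ∧ besselJ' p (u z) ≠ 0 := by
        have h2 : ∀ᶠ w in 𝓝 (u a), w ≠ 0 ∧ besselJ' p w ≠ 0 := by
          rw [hua]
          exact (isOpen_ne.eventually_mem hb0).and
            ((analyticAt_besselJ' p b).continuousAt.eventually_ne hJb')
        exact huan.continuousAt.eventually h2
      have hright : ∀ᶠ z in 𝓝 (a : ℂ), besselRatio p (u z) = besselRatio p z := by
        have h2 := hra.continuousAt.tendsto
        rw [hra0] at h2
        exact h2.eventually hψright
      filter_upwards [hnear, hnearu, hright.eventually_nhds, hre, huan.eventually_analyticAt,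
        hden.continuousAt.eventually_ne hden0] with z ⟨hz, hz'⟩ ⟨huz, huz'⟩ hrz hrez huanz hdz
      have hdu := huanz.differentiableAt.hasDerivAt
      have hcomp : HasDerivAt (fun z => besselRatio p (u z)) _ z :=
        (hasDerivAt_besselRatio p huz huz').comp z hdu
      have h1 := Filter.EventuallyEq.deriv_eq hrz
      rw [hcomp.deriv, (hasDerivAt_besselRatio p hz hz').deriv, hrz.self_of_nhds] at h1
      have hquot : HasDerivAt (fun z => (u z / z) ^ 2) _ z := (hdu.div (hasDerivAt_id z) hz).pow 2
      rw [hquot.deriv]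
      have hd0 := right_ne_zero_of_mul hdz
      have h2 : deriv u z = u z * (1 + (z ^ 2 - p ^ 2) * besselRatio p z ^ 2) /
          (z * (1 + (u z ^ 2 - p ^ 2) * besselRatio p z ^ 2)) := by
        rw [eq_div_iff (mul_ne_zero hz hd0)]
        field_simp at h1
        linear_combination h1
      rw [h2]
      have h3 : (z - a) ^ 2 * (2 * u z ^ 2 * (z ^ 2 - u z ^ 2) * r z ^ 2 /
          (z ^ 3 * (1 + (u z ^ 2 - p ^ 2) * besselRatio p z ^ 2))) =
          2 * u z ^ 2 * (z ^ 2 - u z ^ 2) * besselRatio p z ^ 2 /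
          (z ^ 3 * (1 + (u z ^ 2 - p ^ 2) * besselRatio p z ^ 2)) := by
        rw [hrez]
        ring
      rw [h3]
      simp only [Pi.div_apply, id, Nat.add_one_sub_one, pow_one]
      obtain ⟨D, hD⟩ : ∃ D, D = 1 + (u z ^ 2 - p ^ 2) * besselRatio p z ^ 2 := ⟨_, rfl⟩
      rw [← hD] at hd0 ⊢
      field_simp
      rw [hD]
      push_cast
      ring)
  refine ⟨φ, c, hc, hφ, hφa, hφd, ?_⟩
  have hψleft' := (continuous_snd.tendsto ((a : ℂ), (b : ℂ))).eventually hψleft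
  have hφe' := (continuous_fst.tendsto ((a : ℂ), (b : ℂ))).eventually hφe
  filter_upwards [hψleft', hφe'] with q h1 h2 h3
  rw [h2, hua]
  simp only [hu, h3, h1]

theorem exists_continuous_cube_root :
    ∃ ρ : ℝ → ℝ, Continuous ρ ∧ ∀ x, ρ x ^ 3 = x := by
  have hodd : Odd 3 := by decide
  have hsurj : Function.Surjective (fun x : ℝ => x ^ 3) := by
    intro y
    rcases le_total 0 y with hy | hy
    · exact ⟨y ^ (((3 : ℕ) : ℝ)⁻¹), Real.rpow_inv_natCast_pow hy (by norm_num)⟩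
    · refine ⟨-((-y) ^ (((3 : ℕ) : ℝ)⁻¹)), ?_⟩
      simp only [hodd.neg_pow, Real.rpow_inv_natCast_pow (neg_nonneg.2 hy) three_ne_zero, neg_neg]
  let e := StrictMono.orderIsoOfSurjective (fun x : ℝ => x ^ 3) hodd.strictMono_pow hsurj
  exact ⟨e.symm, e.symm.continuous, fun x => e.apply_symm_apply x⟩

theorem eq_of_cube_eq_neg_one {θ : ℂ} (h : θ ^ 3 = -1) :
    θ = -1 ∨ θ = Complex.exp ((Real.pi / 3 : ℝ) * Complex.I) ∨
      θ = Complex.exp ((-(Real.pi / 3) : ℝ) * Complex.I) := by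
  have h3 : ((√3 : ℝ) : ℂ) ^ 2 = 3 := by
    rw [← Complex.ofReal_pow, Real.sq_sqrt (by norm_num)]
    norm_num
  have e1 : Complex.exp ((Real.pi / 3 : ℝ) * Complex.I) = 1 / 2 + (√3 : ℝ) / 2 * Complex.I := by
    rw [Complex.exp_mul_I, ← Complex.ofReal_cos, ← Complex.ofReal_sin, Real.cos_pi_div_three,
      Real.sin_pi_div_three]
    push_cast
    ring
  have e2 : Complex.exp ((-(Real.pi / 3) : ℝ) * Complex.I) =
      1 / 2 - (√3 : ℝ) / 2 * Complex.I := by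
    rw [Complex.exp_mul_I, ← Complex.ofReal_cos, ← Complex.ofReal_sin, Real.cos_neg,
      Real.sin_neg, Real.cos_pi_div_three, Real.sin_pi_div_three]
    push_cast
    ring
  rw [e1, e2]
  have hfac : (θ + 1) * ((θ - (1 / 2 + (√3 : ℝ) / 2 * Complex.I)) *
      (θ - (1 / 2 - (√3 : ℝ) / 2 * Complex.I))) = 0 := by
    linear_combination h - (θ + 1) / 4 * ((√3 : ℝ) : ℂ) ^ 2 * Complex.I_sq + (θ + 1) / 4 * h3
  rcases mul_eq_zero.1 hfac with h | h
  · exact Or.inl (eq_neg_of_add_eq_zero_left h)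
  · exact Or.inr ((mul_eq_zero.1 h).imp sub_eq_zero.1 sub_eq_zero.1)

theorem arg_of_cube_eq_neg_one {θ : ℂ} (h : θ ^ 3 = -1) :
    θ = -1 ∨ (θ.im ≠ 0 ∧ (Complex.arg θ = -(Real.pi / 3) ∨ Complex.arg θ = Real.pi / 3)) := by
  have hpi := Real.pi_pos
  have hsin : Real.sin (Real.pi / 3) ≠ 0 := by
    rw [Real.sin_pi_div_three]
    positivity
  rcases eq_of_cube_eq_neg_one h with h | h | h
  · exact Or.inl h
  · refine Or.inr ⟨?_, Or.inr ?_⟩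
    · rwa [h, Complex.exp_ofReal_mul_I_im]
    · rw [h, Complex.exp_mul_I, Complex.arg_cos_add_sin_mul_I ⟨by linarith, by linarith⟩]
  · refine Or.inr ⟨?_, Or.inl ?_⟩
    · rwa [h, Complex.exp_ofReal_mul_I_im, Real.sin_neg, neg_ne_zero]
    · rw [h, Complex.exp_mul_I, Complex.arg_cos_add_sin_mul_I ⟨by linarith, by linarith⟩]

/-- On a connected set, a continuous cube root of `-x` is a constant cube root of `-1` times the
real cube root of `x`. -/
theorem exists_eq_mul_of_cube_eq_neg {I : Set ℝ} (hI : IsPreconnected I) {x₀ : ℝ} (hx₀ : x₀ ∉ I)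
    {ρ : ℝ → ℝ} (hρc : Continuous ρ) (hρ : ∀ x, ρ x ^ 3 = x) {f : ℝ → ℂ}
    (hf : ContinuousOn f I) (hf3 : ∀ x ∈ I, f x ^ 3 = -((x : ℂ) - x₀)) :
    ∃ θ : ℂ, θ ^ 3 = -1 ∧ ∀ x ∈ I, f x = θ * ρ (x - x₀) := by
  have hρ0 : ∀ x ∈ I, (ρ (x - x₀) : ℂ) ≠ 0 := by
    intro x hx h
    have h1 := hρ (x - x₀)
    rw [Complex.ofReal_eq_zero.1 h] at h1
    exact hx₀ (by rwa [← sub_eq_zero.1 (show x - x₀ = 0 by rw [← h1]; norm_num)])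
  have hfin : {θ : ℂ | θ ^ 3 = -1}.Finite :=
    (Set.toFinite {-1, Complex.exp ((Real.pi / 3 : ℝ) * Complex.I),
      Complex.exp ((-(Real.pi / 3) : ℝ) * Complex.I)}).subset fun θ h => eq_of_cube_eq_neg_one h
  have hcont : ContinuousOn (fun x => f x / (ρ (x - x₀) : ℂ)) I :=
    hf.div (by fun_prop) hρ0
  obtain ⟨θ, hθ, heq⟩ := hI.eqOn_const_of_mapsTo hfin.isDiscrete hcont
    (fun x hx => by
      have hx3 : (ρ (x - x₀) : ℂ) ^ 3 = x - x₀ := by exact_mod_cast hρ (x - x₀)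
      simp only [Set.mem_ofPred_eq]
      rw [div_pow, hf3 x hx, ← hx3, neg_div, div_self (pow_ne_zero 3 (hρ0 x hx))])
    ⟨-1, by norm_num⟩
  exact ⟨θ, hθ, fun x hx => (div_eq_iff (hρ0 x hx)).1 (heq hx)⟩

/-- Limit of the tangent direction of a curve `κ` along a set `I` where the cube of `φ ∘ κ` is
`x₀ - x`. -/
theorem tendsto_arg_deriv_of_cube_eq {φ : ℂ → ℂ} {a c x₀ : ℝ} (hc : 0 < c)
    (hφ : AnalyticAt ℂ φ a) (hφa : φ a = 0) (hφd : deriv φ a = c) {κ : ℝ → ℂ} {I : Set ℝ}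
    (hIo : IsOpen I) (hIc : IsPreconnected I) (hx₀ : x₀ ∉ I) [NeBot (𝓝[I] x₀)]
    (hκ : Tendsto κ (𝓝[I] x₀) (𝓝 a)) (hκd : ∀ x ∈ I, DifferentiableAt ℝ κ x)
    (han : ∀ x ∈ I, AnalyticAt ℂ φ (κ x) ∧ AnalyticAt ℂ φ (conj (κ x)))
    (hcube : ∀ x ∈ I, φ (κ x) ^ 3 = -((x : ℂ) - x₀) ∧ φ (conj (κ x)) ^ 3 = -((x : ℂ) - x₀)) :
    ∃ L : ℝ, Tendsto (fun x => Complex.arg (deriv κ x)) (𝓝[I] x₀) (𝓝 L) ∧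
      L ∈ ({-(Real.pi / 3), Real.pi / 3, Real.pi} : Set ℝ) ∧
      (L = Real.pi ↔ ∀ᶠ x in 𝓝[I] x₀, (κ x).im = 0) := by
  have hpi := Real.pi_pos
  have hmem : ∀ᶠ x in 𝓝[I] x₀, x ∈ I := self_mem_nhdsWithin
  have hc0 : (c : ℂ) ≠ 0 := by exact_mod_cast hc.ne'
  obtain ⟨ρ, hρc, hρ⟩ := exists_continuous_cube_root
  have hne : ∀ x ∈ I, (x : ℂ) - x₀ ≠ 0 := by
    intro x hx h
    have : x = x₀ := by exact_mod_cast sub_eq_zero.1 h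
    exact hx₀ (this ▸ hx)
  have hρ0 : ∀ x ∈ I, ρ (x - x₀) ≠ 0 := by
    intro x hx h
    have h1 := hρ (x - x₀)
    rw [h] at h1
    exact hne x hx (by exact_mod_cast (show x - x₀ = 0 by rw [← h1]; norm_num))
  have hκa : ∀ x ∈ I, κ x ≠ a := by
    intro x hx h
    have h1 := (hcube x hx).1
    rw [h, hφa] at h1
    exact hne x hx (by linear_combination h1)
  have hcontκ : ContinuousOn κ I := fun x hx => (hκd x hx).continuousAt.continuousWithinAt
  obtain ⟨θ, hθ, hθeq⟩ := exists_eq_mul_of_cube_eq_neg hIc hx₀ hρc hρ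
    (f := fun x => φ (κ x))
    (fun x hx => ContinuousAt.comp_continuousWithinAt (f := κ) (han x hx).1.continuousAt
      (hcontκ x hx))
    (fun x hx => (hcube x hx).1)
  obtain ⟨θ', hθ', hθeq'⟩ := exists_eq_mul_of_cube_eq_neg hIc hx₀ hρc hρ
    (f := fun x => φ (conj (κ x)))
    (fun x hx => ContinuousAt.comp_continuousWithinAt (f := fun x => conj (κ x))
      (han x hx).2.continuousAt
      (Complex.continuous_conj.continuousAt.comp_continuousWithinAt (hcontκ x hx)))
    (fun x hx => (hcube x hx).2)
  have hθ0 : θ ≠ 0 := by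
    rintro rfl
    norm_num at hθ
  have hκconj : Tendsto (fun x => conj (κ x)) (𝓝[I] x₀) (𝓝 a) := by
    have := (Complex.continuous_conj.tendsto (a : ℂ)).comp hκ
    rwa [Complex.conj_ofReal] at this
  have hslope : Tendsto (slope φ a) (𝓝[≠] (a : ℂ)) (𝓝 c) := by
    rw [← hφd]
    exact hφ.differentiableAt.hasDerivAt.tendsto_slope
  have hθθ' : θ' = conj θ := by
    have h1 : Tendsto (fun x => θ * ρ (x - x₀) / (κ x - a)) (𝓝[I] x₀) (𝓝 (c : ℂ)) := by
      refine (hslope.comp (tendsto_nhdsWithin_iff.2 ⟨hκ, hmem.mono hκa⟩)).congr' ?_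
      filter_upwards [hmem] with x hx
      rw [Function.comp, slope_def_field, hφa, sub_zero, hθeq x hx]
    have h2 : Tendsto (fun x => θ' * ρ (x - x₀) / (conj (κ x) - a)) (𝓝[I] x₀) (𝓝 (c : ℂ)) := by
      refine (hslope.comp (tendsto_nhdsWithin_iff.2 ⟨hκconj, hmem.mono fun x hx h => ?_⟩)).congr' ?_
      · exact hκa x hx (by simpa using congrArg conj h)
      · filter_upwards [hmem] with x hx
        rw [Function.comp, slope_def_field, hφa, sub_zero, hθeq' x hx]
    have h3 : Tendsto (fun x => conj θ * ρ (x - x₀) / (conj (κ x) - a)) (𝓝[I] x₀)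
        (𝓝 (c : ℂ)) := by
      have := (Complex.continuous_conj.tendsto (c : ℂ)).comp h1
      simpa [Function.comp_def] using this
    have h4 : Tendsto (fun _ : ℝ => θ' / conj θ) (𝓝[I] x₀) (𝓝 (c / c : ℂ)) := by
      refine (h2.div h3 hc0).congr' ?_
      filter_upwards [hmem] with x hx
      have e1 : (ρ (x - x₀) : ℂ) ≠ 0 := by exact_mod_cast hρ0 x hx
      have e2 : conj (κ x) - a ≠ 0 := fun h => hκa x hx (by
        simpa using congrArg conj (sub_eq_zero.1 h))
      have e3 : conj θ ≠ 0 := by simpa using hθ0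
      simp only [Pi.div_apply]
      field_simp
    have h5 := tendsto_nhds_unique tendsto_const_nhds h4
    rw [div_self hc0, div_eq_one_iff_eq (by simpa using hθ0)] at h5
    exact h5
  have hderiv : ∀ x ∈ I, ((3 * ρ (x - x₀) ^ 2 : ℝ) : ℂ) * deriv κ x = θ / deriv φ (κ x) := by
    intro x hx
    have h1 : HasDerivAt (fun y => φ (κ y)) (deriv φ (κ x) * deriv κ x) x :=
      HasDerivAt.comp x (han x hx).1.differentiableAt.hasDerivAt (hκd x hx).hasDerivAt
    have h2 : HasDerivAt (fun y : ℝ => -((y : ℂ) - x₀)) (-1) x :=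
      ((hasDerivAt_id x).ofReal_comp.sub_const (x₀ : ℂ)).neg
    have h3 : HasDerivAt (fun y => φ (κ y) ^ 3) (-1) x := by
      refine h2.congr_of_eventuallyEq ?_
      filter_upwards [hIo.mem_nhds hx] with y hy using (hcube y hy).1
    have h4 := (h1.pow 3).unique h3
    rw [hθeq x hx] at h4
    push_cast at h4
    have h5 : 3 * (ρ (x - x₀) : ℂ) ^ 2 * deriv κ x * deriv φ (κ x) = θ := by
      linear_combination (-θ) * h4 + 3 * (ρ (x - x₀) : ℂ) ^ 2 * deriv κ x * deriv φ (κ x) * hθ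
    have h6 : deriv φ (κ x) ≠ 0 := right_ne_zero_of_mul (h5.symm ▸ hθ0)
    rw [eq_div_iff h6]
    push_cast
    exact h5
  have hlim : Tendsto (fun x => ((3 * ρ (x - x₀) ^ 2 : ℝ) : ℂ) * deriv κ x) (𝓝[I] x₀)
      (𝓝 (θ / c)) := by
    have h1 : Tendsto (fun x => deriv φ (κ x)) (𝓝[I] x₀) (𝓝 (c : ℂ)) := by
      rw [← hφd]
      exact hφ.deriv.continuousAt.tendsto.comp hκ
    refine (tendsto_const_nhds.div h1 hc0).congr' ?_
    filter_upwards [hmem] with x hx using (hderiv x hx).symm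
  have hpos : ∀ x ∈ I, 0 < 3 * ρ (x - x₀) ^ 2 := fun x hx => by
    have := hρ0 x hx
    positivity
  have hreal : (∀ᶠ x in 𝓝[I] x₀, (κ x).im = 0) → ∀ᶠ x in 𝓝[I] x₀, (deriv κ x).im = 0 := by
    intro h
    filter_upwards [eventually_eventually_nhdsWithin.2 h, hmem] with x hx hxI
    rw [hIo.nhdsWithin_eq hxI] at hx
    have h1 : HasDerivAt (fun y => (κ y).im) (deriv κ x).im x :=
      Complex.imCLM.hasFDerivAt.comp_hasDerivAt x (hκd x hxI).hasDerivAt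
    exact h1.unique ((hasDerivAt_const x (0 : ℝ)).congr_of_eventuallyEq hx)
  rcases arg_of_cube_eq_neg_one hθ with h | ⟨him, harg⟩
  · have hκreal : ∀ᶠ x in 𝓝[I] x₀, (κ x).im = 0 := by
      have hinj := hφ.hasStrictDerivAt.eventually_left_inverse (by rwa [hφd])
      filter_upwards [hκ.eventually hinj, hκconj.eventually hinj, hmem] with x h1 h2 hx
      have h3 : φ (conj (κ x)) = φ (κ x) := by
        rw [hθeq x hx, hθeq' x hx, hθθ', h]
        simp
      rw [h3, h1] at h2
      exact Complex.conj_eq_iff_im.1 h2.symm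
    refine ⟨Real.pi, ?_, by simp, by simpa using hκreal⟩
    refine tendsto_const_nhds.congr' ?_
    have hre : ∀ᶠ x in 𝓝[I] x₀, (((3 * ρ (x - x₀) ^ 2 : ℝ) : ℂ) * deriv κ x).re < 0 := by
      refine ((Complex.continuous_re.tendsto _).comp hlim).eventually_lt_const ?_
      rw [h, Complex.div_ofReal_re]
      exact div_neg_of_neg_of_pos (by norm_num) hc
    filter_upwards [hre, hreal hκreal, hmem] with x h1 h2 hx
    rw [Complex.re_ofReal_mul] at h1
    exact (Complex.arg_eq_pi_iff.2 ⟨by nlinarith [hpos x hx], h2⟩).symm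
  · refine ⟨Complex.arg θ, ?_, ?_, ?_⟩
    · have h1 : θ / c ∈ Complex.slitPlane := by
        refine Complex.mem_slitPlane_iff.2 (Or.inr ?_)
        rw [Complex.div_ofReal_im]
        exact div_ne_zero him hc.ne'
      have h2 : Complex.arg (θ / c) = Complex.arg θ := by
        rw [div_eq_inv_mul, ← Complex.ofReal_inv, Complex.arg_real_mul _ (inv_pos.2 hc)]
      rw [← h2]
      refine ((Complex.continuousAt_arg h1).tendsto.comp hlim).congr' ?_
      filter_upwards [hmem] with x hx
      exact Complex.arg_real_mul _ (hpos x hx)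
    · rcases harg with h | h <;> simp [h]
    · refine ⟨fun h => absurd h ?_, fun h => absurd ?_ him⟩
      · rcases harg with h | h <;> rw [h] <;> linarith
      · have h1 := (Complex.continuous_im.tendsto _).comp hlim
        have h2 : Tendsto (fun _ : ℝ => (0 : ℝ)) (𝓝[I] x₀) (𝓝 (θ / c).im) := by
          refine h1.congr' ?_
          filter_upwards [hreal h] with x hx
          rw [Function.comp, Complex.im_ofReal_mul, hx, mul_zero]
        have h3 := tendsto_nhds_unique h2 tendsto_const_nhds
        rw [Complex.div_ofReal_im] at h3
        exact (div_eq_zero_iff.1 h3).resolve_right hc.ne'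

theorem Fp_eq_zero_imp_besselRatio_eq (p : ℕ) {z : ℂ} {n : ℝ} (hn : 0 < n) (hz : z ≠ 0)
    (h : Fp p z n = 0) (h1 : besselJ' p z ≠ 0) (h2 : besselJ' p ((√n : ℝ) * z) ≠ 0) :
    besselRatio p z = besselRatio p ((√n : ℝ) * z) := by
  have hs : ((√n : ℝ) : ℂ) ≠ 0 := by exact_mod_cast (Real.sqrt_pos.2 hn).ne'
  have h3 := (mul_eq_zero.1 h).resolve_left hz
  rw [besselRatio, besselRatio, div_eq_div_iff (mul_ne_zero hz h1)
    (mul_ne_zero (mul_ne_zero hs hz) h2)]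
  linear_combination (-z) * h3

theorem besselRatio_conj (p : ℕ) {z : ℂ} (hz : z ≠ 0) :
    besselRatio p (conj z) = conj (besselRatio p z) := by
  simp [besselRatio, besselJ_conj, besselJ'_conj p hz]

theorem eventually_nhdsLT_iff_exists_Ioo {P : ℝ → Prop} {x ε : ℝ} (hε : 0 < ε) :
    (∀ᶠ y in 𝓝[<] x, P y) ↔ ∃ δ > 0, δ ≤ ε ∧ ∀ y ∈ Set.Ioo (x - δ) x, P y := by
  constructor
  · intro h
    obtain ⟨l, ⟨hl1, hl2⟩, hl⟩ :=
      (mem_nhdsLT_iff_exists_mem_Ico_Ioo_subset (sub_lt_self x hε)).1 h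
    exact ⟨x - l, sub_pos.2 hl2, by linarith, fun y hy => hl ⟨by linarith [hy.1], hy.2⟩⟩
  · rintro ⟨δ, hδ, -, h⟩
    filter_upwards [Ioo_mem_nhdsLT (sub_lt_self x hδ)] with y hy using h y hy

theorem eventually_nhdsGT_iff_exists_Ioo {P : ℝ → Prop} {x ε : ℝ} (hε : 0 < ε) :
    (∀ᶠ y in 𝓝[>] x, P y) ↔ ∃ δ > 0, δ ≤ ε ∧ ∀ y ∈ Set.Ioo x (x + δ), P y := by
  constructor
  · intro h
    obtain ⟨u, ⟨hu1, hu2⟩, hu⟩ :=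
      (mem_nhdsGT_iff_exists_mem_Ioc_Ioo_subset (lt_add_of_pos_right x hε)).1 h
    exact ⟨u - x, sub_pos.2 hu1, by linarith, fun y hy => hu ⟨hy.1, by linarith [hy.2]⟩⟩
  · rintro ⟨δ, hδ, -, h⟩
    filter_upwards [Ioo_mem_nhdsGT (lt_add_of_pos_right x hδ)] with y hy using h y hy

/-- admissible approach angles of ITE trajectories at an IDE for `n* > 1`. -/
theorem stmt_7 (p : ℕ) (nst : ℝ) (hnst : 1 < nst) (ε : ℝ) (hε : 0 < ε)
    (κ : ℝ → ℂ) (hcont : ContinuousOn κ (Set.Ioo (nst - ε) (nst + ε)))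
    (hF : ∀ n ∈ Set.Ioo (nst - ε) (nst + ε), Fp p (κ n) n = 0)
    (hdiff : ∀ n ∈ Set.Ioo (nst - ε) (nst + ε), n ≠ nst → DifferentiableAt ℝ κ n)
    (κs : ℝ) (hκs : 0 < κs) (hval : κ nst = (κs : ℂ))
    (hJ : besselJ p (κs : ℂ) = 0) (hJ' : besselJ' p (κs : ℂ) ≠ 0)
    (hJne : ∀ n ∈ Set.Ioo (nst - ε) (nst + ε), n ≠ nst →
      besselJ p (κ n) ≠ 0 ∧ besselJ p ((Real.sqrt n : ℂ) * κ n) ≠ 0) :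
    ∃ Lm Lp : ℝ,
      Filter.Tendsto (fun n => Complex.arg (deriv κ n))
        (nhdsWithin nst (Set.Ioo (nst - ε) nst)) (nhds Lm) ∧
      Filter.Tendsto (fun n => Complex.arg (deriv κ n))
        (nhdsWithin nst (Set.Ioo nst (nst + ε))) (nhds Lp) ∧
      Lm ∈ ({-(Real.pi / 3), Real.pi / 3, Real.pi} : Set ℝ) ∧
      Lp ∈ ({-(Real.pi / 3), Real.pi / 3, Real.pi} : Set ℝ) ∧
      (Lm = Real.pi ↔ ∃ δ > 0, δ ≤ ε ∧ ∀ n ∈ Set.Ioo (nst - δ) nst, (κ n).im = 0) ∧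
      (Lp = Real.pi ↔ ∃ δ > 0, δ ≤ ε ∧ ∀ n ∈ Set.Ioo nst (nst + δ), (κ n).im = 0) := by
  have hIoo : Set.Ioo (nst - ε) (nst + ε) ∈ 𝓝 nst :=
    Ioo_mem_nhds (sub_lt_self nst hε) (lt_add_of_pos_right nst hε)
  have hn0 : 0 < nst := one_pos.trans hnst
  set b : ℝ := √nst * κs with hb
  have hs1 : 1 < √nst := by rwa [Real.lt_sqrt one_pos.le, one_pow]
  have hab : κs < b := by nlinarith
  have hb0 : 0 < b := hκs.trans hab
  have hκs0 : (κs : ℂ) ≠ 0 := by exact_mod_cast hκs.ne'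
  have hbc0 : (b : ℂ) ≠ 0 := by exact_mod_cast hb0.ne'
  have hκt : Tendsto κ (𝓝 nst) (𝓝 (κs : ℂ)) := by
    rw [← hval]
    exact (hcont.continuousAt hIoo).tendsto
  have hst : Tendsto (fun n : ℝ => ((√n : ℝ) : ℂ) * κ n) (𝓝 nst) (𝓝 (b : ℂ)) := by
    rw [hb, Complex.ofReal_mul]
    exact ((Complex.continuous_ofReal.comp Real.continuous_sqrt).tendsto nst).mul hκt
  have hFst : Fp p κs nst = 0 := by
    rw [← hval]
    exact hF nst (mem_of_mem_nhds hIoo)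
  have hJb : besselJ p b = 0 := by
    rw [Fp, hJ] at hFst
    have h1 := (mul_eq_zero.1 hFst).resolve_left hκs0
    rw [mul_zero, zero_mul, sub_zero] at h1
    rw [hb, Complex.ofReal_mul]
    exact (mul_eq_zero.1 h1).resolve_left hJ'
  have hJb' : besselJ' p b ≠ 0 := by
    refine besselJ'_ne_zero_of_zero p hbc0 hJb ?_
    refine (hst.mono_left (nhdsWithin_le_nhds (s := Set.Iio nst))).frequently
      (Filter.Eventually.frequently ?_)
    filter_upwards [nhdsWithin_le_nhds hIoo, self_mem_nhdsWithin] with n hn hlt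
    exact (hJne n hn hlt.ne).2
  obtain ⟨φ, c, hc, hφ, hφa, hφd, hφe⟩ :=
    exists_cube_root_of_besselRatio p hκs hab hJ hJ' hJb hJb'
  have hbn : ((b : ℂ) / κs) ^ 2 = nst := by
    have : (b / κs) ^ 2 = nst := by
      rw [hb, mul_div_cancel_right₀ _ hκs.ne', Real.sq_sqrt hn0.le]
    exact_mod_cast this
  have hconj : ∀ {f : ℝ → ℂ} {r : ℝ}, Tendsto f (𝓝 nst) (𝓝 (r : ℂ)) →
      Tendsto (fun n => conj (f n)) (𝓝 nst) (𝓝 (r : ℂ)) := by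
    intro f r hf
    have := (Complex.continuous_conj.tendsto (r : ℂ)).comp hf
    rwa [Complex.conj_ofReal] at this
  have hq := (hκt.prodMk_nhds hst).eventually hφe
  have hqc := ((hconj hκt).prodMk_nhds (hconj hst)).eventually hφe
  have hgood : ∀ᶠ n in 𝓝 nst, (n ≠ nst → DifferentiableAt ℝ κ n) ∧
      (AnalyticAt ℂ φ (κ n) ∧ AnalyticAt ℂ φ (conj (κ n))) ∧
      (φ (κ n) ^ 3 = -((n : ℂ) - nst) ∧ φ (conj (κ n)) ^ 3 = -((n : ℂ) - nst)) := by
    filter_upwards [hq, hqc, hIoo, isOpen_Ioi.mem_nhds hn0, hκt.eventually_ne hκs0,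
      hκt.eventually ((analyticAt_besselJ' p κs).continuousAt.eventually_ne hJ'),
      hst.eventually ((analyticAt_besselJ' p b).continuousAt.eventually_ne hJb'),
      hκt.eventually hφ.eventually_analyticAt, (hconj hκt).eventually hφ.eventually_analyticAt]
      with n h1 h2 hn hpos hκ0 hd1 hd2 ha1 ha2
    have hs0 : ((√n : ℝ) : ℂ) ≠ 0 := by exact_mod_cast (Real.sqrt_pos.2 hpos).ne'
    have hratio := Fp_eq_zero_imp_besselRatio_eq p hpos hκ0 (hF n hn) hd1 hd2
    have hsq : ((√n : ℝ) : ℂ) ^ 2 = n := by exact_mod_cast Real.sq_sqrt (le_of_lt hpos)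
    refine ⟨hdiff n hn, ⟨ha1, ha2⟩, ?_, ?_⟩
    · have h3 := h1 hratio
      rwa [hbn, mul_div_cancel_right₀ _ hκ0, hsq] at h3
    · have h3 := h2 (by
        rw [besselRatio_conj p hκ0, besselRatio_conj p (mul_ne_zero hs0 hκ0), hratio])
      simp only [map_mul, Complex.conj_ofReal] at h3
      rwa [hbn, mul_div_cancel_right₀ _ (by simpa using hκ0), hsq] at h3
  obtain ⟨l, u, ⟨hl, hu⟩, hlu⟩ := mem_nhds_iff_exists_Ioo_subset.1 hgood
  have hgL : ∀ n ∈ Set.Ioo l nst, n ∈ Set.Ioo l u := fun n hn => ⟨hn.1, hn.2.trans hu⟩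
  have hgR : ∀ n ∈ Set.Ioo nst u, n ∈ Set.Ioo l u := fun n hn => ⟨hl.trans hn.1, hn.2⟩
  have eL := nhdsWithin_Ioo_eq_nhdsLT hl
  have eR := nhdsWithin_Ioo_eq_nhdsGT hu
  have : NeBot (𝓝[Set.Ioo l nst] nst) := by
    rw [eL]
    infer_instance
  have : NeBot (𝓝[Set.Ioo nst u] nst) := by
    rw [eR]
    infer_instance
  obtain ⟨Lm, hLm, hLm3, hLmr⟩ := tendsto_arg_deriv_of_cube_eq hc hφ hφa hφd
    (I := Set.Ioo l nst) (x₀ := nst) isOpen_Ioo isPreconnected_Ioo (fun h => h.2.false)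
    (hκt.mono_left nhdsWithin_le_nhds) (fun n hn => (hlu (hgL n hn)).1 hn.2.ne)
    (fun n hn => (hlu (hgL n hn)).2.1) (fun n hn => (hlu (hgL n hn)).2.2)
  obtain ⟨Lp, hLp, hLp3, hLpr⟩ := tendsto_arg_deriv_of_cube_eq hc hφ hφa hφd
    (I := Set.Ioo nst u) (x₀ := nst) isOpen_Ioo isPreconnected_Ioo (fun h => h.1.false)
    (hκt.mono_left nhdsWithin_le_nhds) (fun n hn => (hlu (hgR n hn)).1 hn.1.ne')
    (fun n hn => (hlu (hgR n hn)).2.1) (fun n hn => (hlu (hgR n hn)).2.2)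
  rw [eL] at hLm hLmr
  rw [eR] at hLp hLpr
  refine ⟨Lm, Lp, ?_, ?_, hLm3, hLp3, hLmr.trans (eventually_nhdsLT_iff_exists_Ioo hε),
    hLpr.trans (eventually_nhdsGT_iff_exists_Ioo hε)⟩
  · rwa [nhdsWithin_Ioo_eq_nhdsLT (sub_lt_self nst hε)]
  · rwa [nhdsWithin_Ioo_eq_nhdsGT (lt_add_of_pos_right nst hε)]
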